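/- arXiv:2407.01086 — 2 statements merged into one kernel-verified Lean document; each statement's English description precedes it below -/
import Mathlib

section
/- Define f(λ) = (λ/(sμ))^{√s} / (sμ − λ) for 0 < λ < sμ with s ≥ 2 and μ > 0. Then the second derivative of f with respect to λ is strictly positive on (0, sμ) whenever √s ≠ 2, and f is convex on (0, sμ) for all s ≥ 2 (including s = 4 where the second derivative is nonnegative). -/
theorem hasDerivAt_div_rpow_div_sub {c p x : ℝ} (hx : x ∈ Set.Ioo 0 c) :
    HasDerivAt (fun y : ℝ => (y / c) ^ p / (c - y))
      (p / c * (x / c) ^ (p - 1) / (c - x) + (x / c) ^ p / (c - x) ^ 2) x := by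
  have hc : 0 < c := hx.1.trans hx.2
  have hsub : c - x ≠ 0 := (sub_pos.2 hx.2).ne'
  have hpow : HasDerivAt (fun y : ℝ => (y / c) ^ p) (1 / c * p * (x / c) ^ (p - 1)) x :=
    ((hasDerivAt_id x).div_const c).rpow_const (Or.inl (div_pos hx.1 hc).ne')
  refine (hpow.div ((hasDerivAt_id' x).const_sub c) hsub).congr_deriv ?_
  field_simp
  ring

theorem hasDerivAt_deriv_div_rpow_div_sub {c p x : ℝ} (hx : x ∈ Set.Ioo 0 c) :
    HasDerivAt (deriv fun y : ℝ => (y / c) ^ p / (c - y))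
      (p * (p - 1) / c ^ 2 * (x / c) ^ (p - 2) / (c - x)
        + 2 * p / c * (x / c) ^ (p - 1) / (c - x) ^ 2
        + 2 * (x / c) ^ p / (c - x) ^ 3) x := by
  have hc : 0 < c := hx.1.trans hx.2
  have hsub : c - x ≠ 0 := (sub_pos.2 hx.2).ne'
  have hpow (q : ℝ) : HasDerivAt (fun y : ℝ => (y / c) ^ q) (1 / c * q * (x / c) ^ (q - 1)) x :=
    ((hasDerivAt_id x).div_const c).rpow_const (Or.inl (div_pos hx.1 hc).ne')
  have hlin : HasDerivAt (fun y : ℝ => c - y) (-1) x := (hasDerivAt_id x).const_sub c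
  have hderiv : (deriv fun y : ℝ => (y / c) ^ p / (c - y)) =ᶠ[nhds x]
      fun y => p / c * (y / c) ^ (p - 1) / (c - y) + (y / c) ^ p / (c - y) ^ 2 := by
    filter_upwards [isOpen_Ioo.mem_nhds hx] with y hy
    exact (hasDerivAt_div_rpow_div_sub hy).deriv
  refine HasDerivAt.congr_of_eventuallyEq ?_ hderiv
  refine ((((hpow (p - 1)).const_mul (p / c)).div hlin hsub).add
    ((hpow p).div (hlin.pow 2) (pow_ne_zero 2 hsub))).congr_deriv ?_
  rw [show p - 1 - 1 = p - 2 by ring]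
  simp only [Pi.pow_apply]
  field_simp
  push_cast
  ring

theorem iteratedDeriv_two_div_rpow_div_sub_pos {c p x : ℝ} (hp : 1 < p) (hx : x ∈ Set.Ioo 0 c) :
    0 < iteratedDeriv 2 (fun y : ℝ => (y / c) ^ p / (c - y)) x := by
  rw [iteratedDeriv_succ, iteratedDeriv_one, (hasDerivAt_deriv_div_rpow_div_sub hx).deriv]
  have hx0 : 0 < x := hx.1
  have hc : 0 < c := hx.1.trans hx.2
  have hsub : 0 < c - x := sub_pos.2 hx.2
  have hp1 : 0 < p - 1 := sub_pos.2 hp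
  positivity

theorem strictConvexOn_div_rpow_div_sub {c p : ℝ} (hp : 1 < p) :
    StrictConvexOn ℝ (Set.Ioo 0 c) (fun y : ℝ => (y / c) ^ p / (c - y)) := by
  refine strictConvexOn_of_deriv2_pos' (convex_Ioo 0 c)
    (fun x hx => (hasDerivAt_div_rpow_div_sub hx).continuousAt.continuousWithinAt) fun x hx => ?_
  rw [← iteratedDeriv_eq_iterate]
  exact iteratedDeriv_two_div_rpow_div_sub_pos hp hx

/-- The queueing-delay upper bound f(λ) = (λ/(sμ))^{√s}/(sμ−λ) has strictly positive
second derivative on (0, sμ) whenever √s ≠ 2, and is convex on (0, sμ) for all s ≥ 2. -/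
theorem queue_bound_second_deriv_pos_and_convex (s μ : ℝ) (hs : 2 ≤ s) (hμ : 0 < μ) :
    let f : ℝ → ℝ := fun lam => (lam / (s * μ)) ^ (Real.sqrt s) / (s * μ - lam)
    ((Real.sqrt s ≠ 2) → ∀ lam ∈ Set.Ioo (0 : ℝ) (s * μ), 0 < iteratedDeriv 2 f lam) ∧
      ConvexOn ℝ (Set.Ioo (0 : ℝ) (s * μ)) f := by
  have hp : 1 < Real.sqrt s := Real.lt_sqrt_of_sq_lt (by linarith)
  exact ⟨fun _ _ hx => iteratedDeriv_two_div_rpow_div_sub_pos hp hx,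
    (strictConvexOn_div_rpow_div_sub hp).convexOn⟩
end

section
/- Let μ > 0, s ≥ 2. The M/M/s average operation delay t_oper(s,λ) = C(s, λ/(sμ))/(sμ − λ) + 1/μ, with C the Erlang C formula, satisfies t_oper(s,λ) < (λ/(sμ))^{√s}/(sμ − λ) + 1/μ for all 0 < λ < sμ. Moreover the ratio of the two sides tends to 1 as s → 2 in the sense that C(2, ρ) = ρ^{√2}·(2ρ/(1+ρ))·ρ^{1−√2}… specifically, C(2,ρ) = 2ρ²/(1+ρ) ≤ ρ^{√2} for all ρ ∈ (0,1). -/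
/-- The Erlang C formula for an M/M/s queue with traffic intensity ρ. -/
noncomputable def erlangC (s : ℕ) (ρ : ℝ) : ℝ :=
  ((s * ρ) ^ s / (Nat.factorial s) * (1 / (1 - ρ))) /
    ((∑ k ∈ Finset.range s, (s * ρ) ^ k / (Nat.factorial k)) +
      (s * ρ) ^ s / (Nat.factorial s) * (1 / (1 - ρ)))

open Finset

/-- The probability that `k + 1` independent uniform samples from `s` values are distinct. -/
noncomputable def birthdayTail (s k : ℕ) : ℝ :=
  (s.descFactorial (k + 1) : ℝ) / (s : ℝ) ^ (k + 1)

lemma birthdayTail_nonneg (s k : ℕ) : 0 ≤ birthdayTail s k := by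
  unfold birthdayTail; positivity

lemma birthdayTail_pos {s k : ℕ} (h : k < s) : 0 < birthdayTail s k := by
  have h1 : 0 < s.descFactorial (k + 1) := Nat.descFactorial_pos.2 h
  have h2 : 0 < s := by omega
  unfold birthdayTail; positivity

lemma birthdayTail_zero {s : ℕ} (hs : 0 < s) : birthdayTail s 0 = 1 := by
  have : (s : ℝ) ≠ 0 := by positivity
  simp [birthdayTail, this]

lemma birthdayTail_self (s : ℕ) : birthdayTail s s = 0 := by
  simp [birthdayTail]

lemma birthdayTail_succ (s k : ℕ) :
    birthdayTail s (k + 1) = birthdayTail s k * (((s - (k + 1) : ℕ) : ℝ) / s) := by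
  unfold birthdayTail
  rw [Nat.descFactorial_succ s (k + 1), pow_succ (s : ℝ) (k + 1), Nat.cast_mul,
    div_mul_div_comm, mul_comm ((s - (k + 1) : ℕ) : ℝ)]

lemma birthdayTail_sub_succ {s k : ℕ} (h : k < s) :
    birthdayTail s k - birthdayTail s (k + 1) = birthdayTail s k * ((k + 1) / s) := by
  have h0 : (s : ℝ) ≠ 0 := by
    have : 0 < s := by omega
    positivity
  rw [birthdayTail_succ, Nat.cast_sub h]
  push_cast
  field_simp
  ring

lemma birthdayTail_add_le {s : ℕ} (hs : 0 < s) (i k : ℕ) :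
    birthdayTail s (i + k) ≤ birthdayTail s i * birthdayTail s k := by
  induction k with
  | zero => simp [birthdayTail_zero hs]
  | succ k ih =>
    rw [← add_assoc, birthdayTail_succ, birthdayTail_succ, ← mul_assoc]
    have h : s - (i + k + 1) ≤ s - (k + 1) := by omega
    have := mul_nonneg (birthdayTail_nonneg s i) (birthdayTail_nonneg s k)
    gcongr

lemma sum_succ_mul_birthdayTail {s : ℕ} (hs : 0 < s) :
    ∑ k ∈ range s, ((k : ℝ) + 1) * birthdayTail s k = s := by
  have h0 : (s : ℝ) ≠ 0 := by positivity
  have h := sum_range_sub' (birthdayTail s) s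
  rw [birthdayTail_zero hs, birthdayTail_self, sub_zero] at h
  calc ∑ k ∈ range s, ((k : ℝ) + 1) * birthdayTail s k
      = s * ∑ k ∈ range s, (birthdayTail s k - birthdayTail s (k + 1)) := by
        rw [mul_sum]
        refine sum_congr rfl fun k hk => ?_
        rw [birthdayTail_sub_succ (mem_range.1 hk)]
        field_simp
    _ = s := by rw [h, mul_one]

lemma lt_sq_sum_birthdayTail {s : ℕ} (hs : 2 ≤ s) :
    (s : ℝ) < (∑ k ∈ range s, birthdayTail s k) ^ 2 := by
  have hs0 : 0 < s := by omega
  have hflip : ∑ k ∈ range s, ((k : ℝ) + 1) * birthdayTail s k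
      = ∑ m ∈ range s, ∑ k ∈ range (s - m), birthdayTail s (m + k) := by
    rw [← sum_range_diag_flip s fun i k => birthdayTail s (i + k)]
    refine sum_congr rfl fun m _ => ?_
    rw [sum_congr rfl (g := fun _ => birthdayTail s m) fun k hk => by
      rw [Nat.add_sub_cancel' (Nat.lt_succ_iff.1 (mem_range.1 hk))]]
    simp
  have hle (m : ℕ) : ∑ k ∈ range (s - m), birthdayTail s (m + k)
      ≤ ∑ k ∈ range (s - m), birthdayTail s m * birthdayTail s k :=
    sum_le_sum fun k _ => birthdayTail_add_le hs0 m k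
  rw [← sum_succ_mul_birthdayTail hs0, hflip, sq, sum_mul_sum]
  refine sum_lt_sum (fun m _ => (hle m).trans ?_) ⟨1, mem_range.2 hs, (hle 1).trans_lt ?_⟩
  · exact sum_le_sum_of_subset_of_nonneg (range_subset_range.2 (Nat.sub_le s m))
      fun k _ _ => mul_nonneg (birthdayTail_nonneg s m) (birthdayTail_nonneg s k)
  · exact sum_lt_sum_of_subset (i := s - 1) (range_subset_range.2 (Nat.sub_le s 1))
      (mem_range.2 (by omega)) (by simp)
      (mul_pos (birthdayTail_pos (by omega)) (birthdayTail_pos (by omega)))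
      fun k _ _ => mul_nonneg (birthdayTail_nonneg s 1) (birthdayTail_nonneg s k)

lemma sum_range_succ_mul_sub (b : ℕ → ℝ) (n : ℕ) :
    ∑ k ∈ range n, ((k : ℝ) + 1) * (b k - b (k + 1)) = ∑ k ∈ range n, b k - n * b n := by
  induction n with
  | zero => simp
  | succ n ih => rw [sum_range_succ, sum_range_succ, ih]; push_cast; ring

lemma sum_range_sub_mul_pow (b : ℕ → ℝ) (x : ℝ) (n : ℕ) :
    ∑ k ∈ range n, (b k - b (k + 1)) * x ^ (k + 1)
      = b 0 - b n * x ^ n + (x - 1) * ∑ k ∈ range n, b k * x ^ k := by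
  induction n with
  | zero => simp
  | succ n ih => rw [sum_range_succ, sum_range_succ, ih]; ring

lemma rpow_sum_birthdayTail_le {s : ℕ} (hs : 0 < s) {x : ℝ} (hx : 0 < x) :
    x ^ (∑ k ∈ range s, birthdayTail s k)
      ≤ 1 + (x - 1) * ∑ k ∈ range s, birthdayTail s k * x ^ k := by
  have h := Real.geom_mean_le_arith_mean_weighted (range s)
    (fun k => birthdayTail s k - birthdayTail s (k + 1)) (fun k => x ^ (k + 1))
    (fun k hk => by
      rw [birthdayTail_sub_succ (mem_range.1 hk)]
      exact mul_nonneg (birthdayTail_nonneg s k) (by positivity))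
    (by rw [sum_range_sub', birthdayTail_zero hs, birthdayTail_self, sub_zero])
    (fun k _ => by positivity)
  rw [sum_range_sub_mul_pow, birthdayTail_zero hs, birthdayTail_self, zero_mul, sub_zero] at h
  refine le_trans (le_of_eq ?_) h
  have hmean := sum_range_succ_mul_sub (birthdayTail s) s
  rw [birthdayTail_self, mul_zero, sub_zero] at hmean
  rw [← hmean, Real.rpow_sum_of_pos hx]
  refine prod_congr rfl fun k _ => ?_
  rw [Real.rpow_mul hx.le]
  congr 1
  exact_mod_cast Real.rpow_natCast x (k + 1)

lemma sum_range_pow_div_factorial {s : ℕ} {ρ : ℝ} (hρ : ρ ≠ 0) :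
    ∑ k ∈ range s, (s * ρ) ^ k / (Nat.factorial k)
      = (s * ρ) ^ s / (Nat.factorial s) * ∑ k ∈ range s, birthdayTail s k * ρ⁻¹ ^ (k + 1) := by
  rw [← sum_range_reflect, mul_sum]
  refine sum_congr rfl fun k hk => ?_
  obtain ⟨m, hm⟩ : ∃ m, s = m + (k + 1) := ⟨s - (k + 1), by have := mem_range.1 hk; omega⟩
  have h0 : (s : ℝ) ≠ 0 := by
    have : 0 < s := by omega
    positivity
  have hfac : (Nat.factorial s : ℝ) = Nat.factorial m * s.descFactorial (k + 1) := by
    have := Nat.factorial_mul_descFactorial (show k + 1 ≤ s by omega)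
    rw [show s - (k + 1) = m by omega] at this
    exact_mod_cast this.symm
  have hd : (s.descFactorial (k + 1) : ℝ) ≠ 0 := by
    have : 0 < s.descFactorial (k + 1) := Nat.descFactorial_pos.2 (by omega)
    positivity
  have hpow : (s * ρ) ^ s = (s * ρ) ^ m * ((s : ℝ) ^ (k + 1) * ρ ^ (k + 1)) := by
    rw [← mul_pow, ← pow_add, ← hm]
  rw [show s - 1 - k = m by omega, hfac, hpow, birthdayTail, inv_pow]
  field_simp

lemma erlangC_eq_inv {s : ℕ} (hs : 0 < s) {ρ : ℝ} (hρ : 0 < ρ) (hρ1 : ρ < 1) :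
    erlangC s ρ = (1 + (ρ⁻¹ - 1) * ∑ k ∈ range s, birthdayTail s k * ρ⁻¹ ^ k)⁻¹ := by
  have h1 : 0 < 1 - ρ := sub_pos.2 hρ1
  set S := ∑ k ∈ range s, birthdayTail s k * ρ⁻¹ ^ k with hS
  have hS' : ∑ k ∈ range s, birthdayTail s k * ρ⁻¹ ^ (k + 1) = ρ⁻¹ * S := by
    rw [hS, mul_sum]
    exact sum_congr rfl fun k _ => by ring
  have hc : 0 < (s * ρ) ^ s / (Nat.factorial s : ℝ) := by positivity
  rw [erlangC, sum_range_pow_div_factorial hρ.ne', hS']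
  set c := (s * ρ) ^ s / (Nat.factorial s : ℝ)
  have hden : c * (ρ⁻¹ * S) + c * (1 / (1 - ρ))
      = c * (1 / (1 - ρ)) * (1 + (ρ⁻¹ - 1) * S) := by
    field_simp
    ring
  rw [hden, div_mul_eq_div_div, div_self (by positivity), one_div]

/-- Harel's bound: `C(s, ρ) < ρ ^ √s`. -/
lemma erlangC_lt_rpow_sqrt {s : ℕ} (hs : 2 ≤ s) {ρ : ℝ} (hρ : 0 < ρ) (hρ1 : ρ < 1) :
    erlangC s ρ < ρ ^ Real.sqrt s := by
  have hs0 : 0 < s := by omega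
  have hsqrt : Real.sqrt s < ∑ k ∈ range s, birthdayTail s k :=
    (Real.sqrt_lt' (sum_pos (fun k hk => birthdayTail_pos (mem_range.1 hk))
      ⟨0, mem_range.2 hs0⟩)).2 (lt_sq_sum_birthdayTail hs)
  have hlt := (Real.rpow_lt_rpow_of_exponent_lt (one_lt_inv_iff₀.2 ⟨hρ, hρ1⟩) hsqrt).trans_le
    (rpow_sum_birthdayTail_le hs0 (inv_pos.2 hρ))
  rw [erlangC_eq_inv hs0 hρ hρ1]
  refine inv_lt_of_inv_lt₀ (by positivity) ?_
  rwa [← Real.inv_rpow hρ.le]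

lemma erlangC_two {ρ : ℝ} (hρ : 0 < ρ) (hρ1 : ρ < 1) :
    erlangC 2 ρ = 2 * ρ ^ 2 / (1 + ρ) := by
  have h1 : 0 < 1 - ρ := sub_pos.2 hρ1
  have hden : 0 < 1 + 2 * ρ + (2 * ρ) ^ 2 / 2 * (1 / (1 - ρ)) := by positivity
  simp only [erlangC, sum_range_succ, sum_range_zero, Nat.factorial, Nat.cast_ofNat]
  norm_num
  rw [div_eq_div_iff (by simpa using hden.ne') (by positivity)]
  field_simp
  ring

/-- Harel's bound on the M/M/s operation delay, with tightness at s = 2: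
t_oper(s,λ) < (λ/(sμ))^{√s}/(sμ−λ) + 1/μ, and C(2,ρ) = 2ρ²/(1+ρ) ≤ ρ^{√2}. -/
theorem operation_delay_upper_bound (s : ℕ) (hs : 2 ≤ s) (μ : ℝ) (hμ : 0 < μ) :
    (∀ lam : ℝ, 0 < lam → lam < s * μ →
      erlangC s (lam / (s * μ)) / (s * μ - lam) + 1 / μ <
        (lam / (s * μ)) ^ (Real.sqrt s) / (s * μ - lam) + 1 / μ) ∧
    (∀ ρ ∈ Set.Ioo (0 : ℝ) 1,
      erlangC 2 ρ = 2 * ρ ^ 2 / (1 + ρ) ∧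
        2 * ρ ^ 2 / (1 + ρ) ≤ ρ ^ (Real.sqrt 2)) := by
  refine ⟨fun lam h0 h1 => ?_, fun ρ ⟨h0, h1⟩ => ⟨erlangC_two h0 h1, ?_⟩⟩
  · have hsμ : 0 < (s : ℝ) * μ := h0.trans h1
    have := erlangC_lt_rpow_sqrt hs (div_pos h0 hsμ) ((div_lt_one hsμ).2 h1)
    have hgap : 0 < s * μ - lam := sub_pos.2 h1
    gcongr
  · rw [← erlangC_two h0 h1]
    exact_mod_cast (erlangC_lt_rpow_sqrt le_rfl h0 h1).le
end
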